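/- Let c₀ > 0 be fixed, and for real x set α = x^{log₃ x/(4 log₂ x)} and y = c₀·x·(log x · log₃ x)/log₂ x. Then for every ε > 0, for all sufficiently large x, the number of integers n ∈ [1, y] all of whose prime factors are at most α is at most y/(log x)^{4−ε}; in particular this count is o(x/log x) as x → ∞. -/

import Mathlib

open scoped Classical

/-- iterated logarithm: `log₂ x = log log x`. -/
noncomputable def log2 (x : ℝ) : ℝ := Real.log (Real.log x)
/-- iterated logarithm: `log₃ x = log log log x`. -/
noncomputable def log3 (x : ℝ) : ℝ := Real.log (log2 x)
/-- the smoothness parameter `α = x^{log₃ x/(4 log₂ x)}`. -/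
noncomputable def alpha (x : ℝ) : ℝ := x ^ (log3 x / (4 * log2 x))
/-- `y = c₀ x (log x · log₃ x)/log₂ x`. -/
noncomputable def yOf (c₀ x : ℝ) : ℝ := c₀ * x * (Real.log x * log3 x) / log2 x

section SmoothCounting

open Real Finset
open scoped ArithmeticFunction.vonMangoldt Chebyshev

/-- The `N`-smooth positive integers not exceeding `y`, in the strict sense of
`Nat.smoothNumbers`. -/
noncomputable def smoothUpTo (N : ℕ) (y : ℝ) : Finset ℕ :=
  {n ∈ Ioc 0 ⌊y⌋₊ | n ∈ Nat.smoothNumbers N}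

lemma mem_smoothUpTo {N : ℕ} {y : ℝ} {n : ℕ} :
    n ∈ smoothUpTo N y ↔ (0 < n ∧ n ≤ ⌊y⌋₊) ∧ n ∈ Nat.smoothNumbers N := by
  simp [smoothUpTo]

/-- A crude form of Mertens' first theorem for the von Mangoldt function. -/
lemma sum_vonMangoldt_div_le (N : ℕ) :
    ∑ d ∈ Ioc 0 N, Λ d / d ≤ 2 * log N := by
  rcases Nat.eq_zero_or_pos N with rfl | hN
  · simp
  have hN' : (0 : ℝ) < N := by exact_mod_cast hN
  have h1 : ∑ d ∈ Ioc 0 N, Λ d * ((N / d : ℕ) : ℝ) = ∑ n ∈ Ioc 0 N, log n := by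
    rw [← ArithmeticFunction.sum_Ioc_mul_zeta_eq_sum,
      ArithmeticFunction.vonMangoldt_mul_zeta]
    simp [ArithmeticFunction.log_apply]
  have h2 : ∑ n ∈ Ioc 0 N, log (n : ℝ) ≤ N * log N := by
    calc ∑ n ∈ Ioc 0 N, log (n : ℝ) ≤ ∑ n ∈ Ioc 0 N, log (N : ℝ) := by
          refine sum_le_sum fun n hn => ?_
          rw [mem_Ioc] at hn
          exact log_le_log (by exact_mod_cast hn.1) (by exact_mod_cast hn.2)
      _ = N * log N := by simp
  have h3 : N * ∑ d ∈ Ioc 0 N, Λ d / d ≤ 2 * ∑ d ∈ Ioc 0 N, Λ d * ((N / d : ℕ) : ℝ) := by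
    rw [mul_sum, mul_sum]
    refine sum_le_sum fun d hd => ?_
    rw [mem_Ioc] at hd
    have hd' : (0 : ℝ) < d := by exact_mod_cast hd.1
    have hq : (1 : ℝ) ≤ ((N / d : ℕ) : ℝ) := by
      exact_mod_cast Nat.div_pos hd.2 hd.1
    have hlt : (N : ℝ) / d < ((N / d : ℕ) : ℝ) + 1 := by
      rw [← Nat.floor_div_eq_div (K := ℝ)]
      exact Nat.lt_floor_add_one _
    have : (N : ℝ) / d ≤ 2 * ((N / d : ℕ) : ℝ) := by linarith
    calc N * (Λ d / d) = Λ d * (N / d) := by ring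
      _ ≤ Λ d * (2 * ((N / d : ℕ) : ℝ)) :=
          mul_le_mul_of_nonneg_left this ArithmeticFunction.vonMangoldt_nonneg
      _ = _ := by ring
  have h4 : N * ∑ d ∈ Ioc 0 N, Λ d / d ≤ N * (2 * log N) := by linarith
  exact le_of_mul_le_mul_left h4 hN'

lemma sum_primesLE_log_div_le (N : ℕ) :
    ∑ p ∈ Nat.primesLE N, log p / p ≤ 2 * log N := by
  refine le_trans ?_ (sum_vonMangoldt_div_le N)
  rw [Nat.primesLE_eq_filter_Icc_zero, sum_filter]
  refine le_trans (sum_le_sum (g := fun d => Λ d / d) fun d _ => ?_) ?_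
  · split_ifs with h
    · rw [ArithmeticFunction.vonMangoldt_apply_prime h]
    · exact div_nonneg ArithmeticFunction.vonMangoldt_nonneg (Nat.cast_nonneg _)
  · rw [← add_sum_Ioc_eq_sum_Icc (by omega)]
    simp

/-- Double counting of `log n = ∑ d ∣ n, Λ d` over smooth `n`. -/
lemma sum_log_smoothUpTo_le (N : ℕ) (y : ℝ) :
    ∑ n ∈ smoothUpTo N y, log n ≤
      ∑ m ∈ smoothUpTo N y, ∑ d ∈ smoothUpTo N (y / m), Λ d := by
  have h1 : ∑ n ∈ smoothUpTo N y, log n =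
      ∑ n ∈ smoothUpTo N y, ∑ m ∈ n.divisors, Λ (n / m) := by
    refine sum_congr rfl fun n _ => ?_
    rw [← ArithmeticFunction.vonMangoldt_sum, Nat.sum_div_divisors n (fun d => Λ d)]
  have h2 : ∑ n ∈ smoothUpTo N y, ∑ m ∈ n.divisors, Λ (n / m) =
      ∑ m ∈ smoothUpTo N y, ∑ n ∈ smoothUpTo N y with m ∣ n, Λ (n / m) := by
    refine sum_comm' fun n m => ?_
    simp only [mem_smoothUpTo, Nat.mem_divisors, mem_filter]
    constructor
    · rintro ⟨⟨⟨h0, hy⟩, hs⟩, hd, hn⟩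
      exact ⟨⟨⟨⟨h0, hy⟩, hs⟩, hd⟩, ⟨Nat.pos_of_dvd_of_pos hd h0, (Nat.le_of_dvd h0 hd).trans hy⟩,
        Nat.mem_smoothNumbers_of_dvd hs hd⟩
    · rintro ⟨⟨⟨⟨h0, hy⟩, hs⟩, hd⟩, -⟩
      exact ⟨⟨⟨h0, hy⟩, hs⟩, hd, h0.ne'⟩
  rw [h1, h2]
  refine sum_le_sum fun m hm => ?_
  have hm0 : 0 < m := (mem_smoothUpTo.1 hm).1.1
  have hinj : Set.InjOn (fun n => n / m) ({n ∈ smoothUpTo N y | m ∣ n} : Finset ℕ) := by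
    intro a ha b hb hab
    simp only [coe_filter, Set.mem_ofPred_eq] at ha hb
    have := congrArg (m * ·) hab
    simpa [Nat.mul_div_cancel' ha.2, Nat.mul_div_cancel' hb.2] using this
  rw [← sum_image (f := fun d => Λ d) hinj]
  refine sum_le_sum_of_subset_of_nonneg ?_ fun _ _ _ => ArithmeticFunction.vonMangoldt_nonneg
  intro d hd
  obtain ⟨n, hn, rfl⟩ := mem_image.1 hd
  obtain ⟨hn, hmn⟩ := mem_filter.1 hn
  obtain ⟨⟨h0, hy⟩, hs⟩ := mem_smoothUpTo.1 hn
  refine mem_smoothUpTo.2 ⟨⟨Nat.div_pos (Nat.le_of_dvd h0 hmn) hm0, ?_⟩,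
    Nat.mem_smoothNumbers_of_dvd hs (Nat.div_dvd_of_dvd hmn)⟩
  rw [Nat.floor_div_natCast]
  exact Nat.div_le_div_right hy

/-- Chebyshev-type bound for the von Mangoldt function restricted to smooth numbers. -/
lemma sum_vonMangoldt_smoothUpTo_le {A t σ : ℝ} (hA : 1 ≤ A) (ht : 1 ≤ t)
    (hσ : 3 / 4 ≤ σ) (hσ1 : σ ≤ 1) :
    ∑ d ∈ smoothUpTo (⌊A⌋₊ + 1) t, Λ d ≤ 14 * (t ^ σ * A ^ (1 - σ)) := by
  have hA0 : 0 < A := by linarith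
  have ht0 : 0 < t := by linarith
  have hlog4 : log 4 + 4 ≤ 6 := by
    have : log 4 = 2 * log 2 := by
      rw [show (4 : ℝ) = 2 ^ 2 by norm_num, log_pow]; norm_num
    linarith [log_two_lt_d9]
  have hpsi : ∀ z : ℝ, 0 ≤ z → ψ z ≤ 6 * z := fun z hz =>
    (Chebyshev.psi_le_const_mul_self hz).trans (by gcongr)
  have hsplit : ∀ z : ℝ, 0 < z → z ^ σ * z ^ (1 - σ) = z := fun z hz => by
    rw [← rpow_add hz]; simp
  have hpos : 0 < t ^ σ * A ^ (1 - σ) := by positivity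
  rcases le_or_gt t A with htA | hAt
  · have h1 : ∑ d ∈ smoothUpTo (⌊A⌋₊ + 1) t, Λ d ≤ ψ t :=
      sum_le_sum_of_subset_of_nonneg (filter_subset _ _)
        fun _ _ _ => ArithmeticFunction.vonMangoldt_nonneg
    have h2 : t ≤ t ^ σ * A ^ (1 - σ) := by
      calc t = t ^ σ * t ^ (1 - σ) := (hsplit t ht0).symm
        _ ≤ t ^ σ * A ^ (1 - σ) := by
          gcongr
    linarith [hpsi t ht0.le]
  · have h1 : ∑ d ∈ smoothUpTo (⌊A⌋₊ + 1) t, Λ d ≤ ψ A + (ψ t - θ t) := by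
      rw [Chebyshev.psi_sub_theta_eq_sum_not_prime, Chebyshev.psi]
      refine le_trans (sum_le_sum_of_subset_of_nonneg (t := Ioc 0 ⌊A⌋₊ ∪
        {n ∈ Ioc 0 ⌊t⌋₊ | ¬ n.Prime}) ?_ fun _ _ _ => ArithmeticFunction.vonMangoldt_nonneg) ?_
      · intro d hd
        obtain ⟨⟨h0, hy⟩, hs⟩ := mem_smoothUpTo.1 hd
        simp only [mem_union, mem_Ioc, mem_filter]
        by_cases hp : d.Prime
        · have := (Nat.mem_smoothNumbers'.1 hs) d hp dvd_rfl
          exact Or.inl ⟨h0, by omega⟩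
        · exact Or.inr ⟨⟨h0, hy⟩, hp⟩
      · rw [← sum_union_inter]
        exact le_add_of_nonneg_right
          (sum_nonneg fun _ _ => ArithmeticFunction.vonMangoldt_nonneg)
    have h2 : A ≤ t ^ σ * A ^ (1 - σ) := by
      calc A = A ^ σ * A ^ (1 - σ) := (hsplit A hA0).symm
        _ ≤ t ^ σ * A ^ (1 - σ) := by gcongr
    have h3 : ψ t - θ t ≤ 8 * (t ^ σ * A ^ (1 - σ)) := by
      have hl : log t ≤ t ^ (1 / 4 : ℝ) / (1 / 4) := log_le_rpow_div ht0.le (by norm_num)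
      calc ψ t - θ t ≤ 2 * √t * log t := Chebyshev.psi_sub_theta_le ht
        _ ≤ 2 * √t * (t ^ (1 / 4 : ℝ) / (1 / 4)) := by gcongr
        _ = 8 * (t ^ (1 / 2 : ℝ) * t ^ (1 / 4 : ℝ)) := by rw [sqrt_eq_rpow]; ring
        _ = 8 * t ^ (3 / 4 : ℝ) := by rw [← rpow_add ht0]; norm_num
        _ ≤ 8 * (t ^ σ * 1) := by
          rw [mul_one]
          gcongr
        _ ≤ 8 * (t ^ σ * A ^ (1 - σ)) := by
          gcongr
          exact one_le_rpow hA (by linarith)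
    linarith [hpsi A hA0.le]

/-- The completely multiplicative function `n ↦ n ^ (-σ)`. -/
noncomputable def rpowNegHom (σ : ℝ) : ℕ →* ℝ where
  toFun n := (n : ℝ) ^ (-σ)
  map_one' := by simp
  map_mul' a b := by
    push_cast
    exact mul_rpow (Nat.cast_nonneg _) (Nat.cast_nonneg _)

lemma rpowNegHom_apply (σ : ℝ) (n : ℕ) : rpowNegHom σ n = (n : ℝ) ^ (-σ) := rfl

lemma prime_rpow_neg_le {p : ℕ} (hp : p.Prime) {σ : ℝ} (hσ : 1 / 2 ≤ σ) :
    (p : ℝ) ^ (-σ) ≤ 3 / 4 := by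
  have h2 : (2 : ℝ) ≤ p := by exact_mod_cast hp.two_le
  calc (p : ℝ) ^ (-σ) ≤ (p : ℝ) ^ (-(1 / 2) : ℝ) :=
        rpow_le_rpow_of_exponent_le (by linarith) (by linarith)
    _ ≤ (2 : ℝ) ^ (-(1 / 2) : ℝ) := rpow_le_rpow_of_nonpos (by norm_num) h2 (by norm_num)
    _ = (√2)⁻¹ := by rw [rpow_neg (by norm_num), sqrt_eq_rpow]
    _ ≤ (4 / 3)⁻¹ := by
        gcongr
        exact le_sqrt_of_sq_le (by norm_num)
    _ = 3 / 4 := by norm_num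

lemma sum_smoothUpTo_rpow_neg_le (N : ℕ) (y : ℝ) {σ : ℝ} (hσ : 1 / 2 ≤ σ) :
    ∑ m ∈ smoothUpTo N y, (m : ℝ) ^ (-σ) ≤
      ∏ p ∈ Nat.primesBelow N, (1 - (p : ℝ) ^ (-σ))⁻¹ := by
  have hnorm : ∀ {p : ℕ}, p.Prime → ‖rpowNegHom σ p‖ < 1 := fun {p} hp => by
    rw [rpowNegHom_apply, norm_of_nonneg (by positivity)]
    linarith [prime_rpow_neg_le hp hσ]
  have hs := (EulerProduct.summable_and_hasSum_smoothNumbers_prod_primesBelow_geometric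
    hnorm N).2
  simp only [rpowNegHom_apply] at hs
  rw [← hs.tsum_eq]
  have hle := hs.summable.sum_le_tsum
    ((smoothUpTo N y).subtype (· ∈ Nat.smoothNumbers N)) (fun _ _ => by positivity)
  rwa [sum_subtype_of_mem (fun m : ℕ => (m : ℝ) ^ (-σ))
    (fun m hm => (mem_smoothUpTo.1 hm).2)] at hle

lemma prod_primesBelow_le_tsum (N : ℕ) {s : ℝ} (hs : 1 < s) :
    ∏ p ∈ Nat.primesBelow N, (1 - (p : ℝ) ^ (-s))⁻¹ ≤ ∑' n : ℕ, 1 / (n : ℝ) ^ s := by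
  have hsum : Summable fun n : ℕ => (n : ℝ) ^ (-s) := summable_nat_rpow.2 (by linarith)
  have h := EulerProduct.prod_primesBelow_geometric_eq_tsum_smoothNumbers
    (f := rpowNegHom s) hsum N
  simp only [rpowNegHom_apply] at h
  rw [h]
  refine (Summable.tsum_subtype_le (fun n : ℕ => (n : ℝ) ^ (-s)) _
    (fun n => by positivity) hsum).trans_eq ?_
  exact tsum_congr fun n => by rw [rpow_neg (Nat.cast_nonneg _), one_div]

lemma inv_one_sub_le_mul_exp {a b : ℝ} (hab : a ≤ b) (hb : b ≤ 3 / 4) :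
    (1 - b)⁻¹ ≤ (1 - a)⁻¹ * exp (4 * (b - a)) := by
  have h1 : 0 < 1 - b := by linarith
  have h2 : 0 < 1 - a := by linarith
  rw [inv_le_iff_one_le_mul₀ h1]
  have h3 : 1 + 4 * (b - a) ≤ exp (4 * (b - a)) := by
    linarith [add_one_le_exp (4 * (b - a))]
  have h4 : 1 - a ≤ (1 - b) * exp (4 * (b - a)) := by
    nlinarith [mul_le_mul_of_nonneg_left h3 h1.le]
  calc (1 : ℝ) = (1 - a)⁻¹ * (1 - a) := by field_simp
    _ ≤ (1 - a)⁻¹ * ((1 - b) * exp (4 * (b - a))) := by gcongr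
    _ = _ := by ring

/-- Comparison of powers of `p` with exponents on either side of `-1`. -/
lemma rpow_neg_sub_rpow_neg_le {p L η : ℝ} (hp : 1 ≤ p) (hL : 0 < L) (hpL : log p ≤ L)
    (hη : 0 ≤ η) :
    p ^ (-(1 - η / L)) - p ^ (-(1 + 1 / L)) ≤ (η + 1) * exp η / L * (log p / p) := by
  have hp0 : 0 < p := by linarith
  have hlog : 0 ≤ log p := log_nonneg hp
  set v := log p / L with hv
  have hv0 : 0 ≤ v := by positivity
  have hv1 : v ≤ 1 := by rw [hv, div_le_one hL]; exact hpL
  have e1 : p ^ (-(1 - η / L)) = p⁻¹ * exp (η * v) := by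
    rw [rpow_def_of_pos hp0, ← exp_log (inv_pos.2 hp0), ← exp_add, log_inv, hv]
    congr 1; field_simp; ring
  have e2 : p ^ (-(1 + 1 / L)) = p⁻¹ * exp (η * v) * exp (-((η + 1) * v)) := by
    rw [rpow_def_of_pos hp0, ← exp_log (inv_pos.2 hp0), ← exp_add, ← exp_add, log_inv, hv]
    congr 1; field_simp; ring
  have h3 : 1 - exp (-((η + 1) * v)) ≤ (η + 1) * v := by
    linarith [add_one_le_exp (-((η + 1) * v))]
  have h4 : exp (η * v) ≤ exp η := exp_le_exp.2 (by nlinarith)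
  calc p ^ (-(1 - η / L)) - p ^ (-(1 + 1 / L))
      = p⁻¹ * exp (η * v) * (1 - exp (-((η + 1) * v))) := by rw [e1, e2]; ring
    _ ≤ p⁻¹ * exp (η * v) * ((η + 1) * v) := by gcongr
    _ ≤ p⁻¹ * exp η * ((η + 1) * v) := by gcongr
    _ = _ := by rw [hv]; field_simp

/-- Upper bound for the Euler product over the primes up to `A`, slightly to the left of `1`. -/
lemma prod_primesBelow_le {A η : ℝ} (hA : 1 < A) (hη : 0 ≤ η) (hηA : 4 * η ≤ log A) :
    ∏ p ∈ Nat.primesBelow (⌊A⌋₊ + 1), (1 - (p : ℝ) ^ (-(1 - η / log A)))⁻¹ ≤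
      (∑' n : ℕ, 1 / (n : ℝ) ^ (1 + 1 / log A)) * exp (8 * ((η + 1) * exp η)) := by
  set L := log A with hL
  have hL0 : 0 < L := log_pos hA
  have hσ : 1 / 2 ≤ 1 - η / L := by
    have : η / L ≤ 1 / 4 := by rw [div_le_iff₀ hL0]; linarith
    linarith
  have hprime : ∀ p ∈ Nat.primesBelow (⌊A⌋₊ + 1), p.Prime ∧ (1 : ℝ) ≤ p ∧ log p ≤ L := by
    intro p hp
    have hpp := Nat.prime_of_mem_primesBelow hp
    have h1 : (1 : ℝ) ≤ p := by exact_mod_cast hpp.one_le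
    have h2 : p ≤ ⌊A⌋₊ := Nat.lt_succ_iff.1 (Nat.lt_of_mem_primesBelow hp)
    exact ⟨hpp, h1, log_le_log (by linarith) ((Nat.le_floor_iff (by linarith)).1 h2)⟩
  have hle : ∀ p ∈ Nat.primesBelow (⌊A⌋₊ + 1),
      (p : ℝ) ^ (-(1 + 1 / L)) ≤ (p : ℝ) ^ (-(1 - η / L)) := fun p hp =>
    rpow_le_rpow_of_exponent_le (hprime p hp).2.1 (by
      have : 0 ≤ η / L := by positivity
      have : 0 ≤ 1 / L := by positivity
      linarith)
  have hdiff : ∑ p ∈ Nat.primesBelow (⌊A⌋₊ + 1),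
      ((p : ℝ) ^ (-(1 - η / L)) - (p : ℝ) ^ (-(1 + 1 / L))) ≤ 2 * ((η + 1) * exp η) := by
    have hfl : (1 : ℝ) ≤ ⌊A⌋₊ := by exact_mod_cast (Nat.one_le_floor_iff A).2 hA.le
    calc _ ≤ ∑ p ∈ Nat.primesBelow (⌊A⌋₊ + 1), (η + 1) * exp η / L * (log p / p) :=
          sum_le_sum fun p hp =>
            rpow_neg_sub_rpow_neg_le (hprime p hp).2.1 hL0 (hprime p hp).2.2 hη
      _ = (η + 1) * exp η / L * ∑ p ∈ Nat.primesLE ⌊A⌋₊, log p / p := by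
          rw [← mul_sum]; rfl
      _ ≤ (η + 1) * exp η / L * (2 * L) := by
          gcongr
          refine (sum_primesLE_log_div_le _).trans ?_
          gcongr
          exact log_le_log (by linarith) (Nat.floor_le (by linarith))
      _ = _ := by field_simp
  calc _ ≤ ∏ p ∈ Nat.primesBelow (⌊A⌋₊ + 1), ((1 - (p : ℝ) ^ (-(1 + 1 / L)))⁻¹ *
        exp (4 * ((p : ℝ) ^ (-(1 - η / L)) - (p : ℝ) ^ (-(1 + 1 / L))))) := by
        refine prod_le_prod (fun p hp => ?_) fun p hp => ?_
        · have := prime_rpow_neg_le (hprime p hp).1 hσ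
          exact inv_nonneg.2 (by linarith)
        · exact inv_one_sub_le_mul_exp (hle p hp) (prime_rpow_neg_le (hprime p hp).1 hσ)
    _ = (∏ p ∈ Nat.primesBelow (⌊A⌋₊ + 1), (1 - (p : ℝ) ^ (-(1 + 1 / L)))⁻¹) *
        exp (4 * ∑ p ∈ Nat.primesBelow (⌊A⌋₊ + 1),
          ((p : ℝ) ^ (-(1 - η / L)) - (p : ℝ) ^ (-(1 + 1 / L)))) := by
        rw [prod_mul_distrib, ← exp_sum, mul_sum]
    _ ≤ _ := by
        have h1L : 0 < 1 / L := by positivity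
        refine mul_le_mul (prod_primesBelow_le_tsum _ (by linarith)) ?_ (exp_pos _).le
          (tsum_nonneg fun n => by positivity)
        exact exp_le_exp.2 (by linarith)

lemma exists_tsum_one_div_rpow_le :
    ∃ L₀ : ℝ, 1 ≤ L₀ ∧ ∀ L : ℝ, L₀ ≤ L → ∑' n : ℕ, 1 / (n : ℝ) ^ (1 + 1 / L) ≤ 2 * L := by
  have h := (tendsto_sub_mul_tsum_nat_rpow.eventually (Iio_mem_nhds one_lt_two))
  have ht : Filter.Tendsto (fun L : ℝ => 1 + 1 / L) Filter.atTop (nhdsWithin 1 (Set.Ioi 1)) := by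
    refine tendsto_nhdsWithin_iff.2 ⟨?_, ?_⟩
    · simpa using (tendsto_inv_atTop_zero (𝕜 := ℝ)).const_add 1
    · filter_upwards [Filter.eventually_gt_atTop 0] with L hL
      simpa using hL
  obtain ⟨L₀, hL₀⟩ := Filter.eventually_atTop.1 (ht.eventually h)
  refine ⟨max L₀ 1, le_max_right _ _, fun L hL => ?_⟩
  have h1 : (1 : ℝ) ≤ L := (le_max_right _ _).trans hL
  have h2 := hL₀ L ((le_max_left _ _).trans hL)
  have h0 : 0 < L := by linarith
  simp only [add_sub_cancel_left] at h2
  rw [one_div_mul_eq_div, div_lt_iff₀ h0] at h2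
  exact h2.le

/-- Rankin-type bound for smooth numbers, without loss of a factor `log y`. -/
lemma exists_card_smoothUpTo_le :
    ∃ L₀ : ℝ, 1 ≤ L₀ ∧ ∀ A y η : ℝ, 0 < A → L₀ ≤ log A → A ≤ y → 0 ≤ η → 4 * η ≤ log A →
      ((smoothUpTo (⌊A⌋₊ + 1) y).card : ℝ) ≤
        √y + 56 * y * exp (η - η * (log y / log A) + 8 * ((η + 1) * exp η)) := by
  obtain ⟨L₀, hL₀, hzeta⟩ := exists_tsum_one_div_rpow_le
  refine ⟨L₀, hL₀, fun A y η hA0 hLA hAy hη hηA => ?_⟩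
  set L := log A with hL
  set S := smoothUpTo (⌊A⌋₊ + 1) y with hS
  set E := exp (8 * ((η + 1) * exp η)) with hE
  have hL1 : 1 ≤ L := hL₀.trans hLA
  have hL0 : 0 < L := by linarith
  have hA1 : 1 < A := (log_pos_iff hA0.le).1 hL0
  have hy1 : 1 < y := by linarith
  have hy0 : 0 < y := by linarith
  have hLy : L ≤ log y := log_le_log hA0 hAy
  have hηL : η / L ≤ 1 / 4 := by rw [div_le_iff₀ hL0]; linarith
  have hηL0 : 0 ≤ η / L := by positivity
  set σ := 1 - η / L with hσ
  have hlower : (S.card : ℝ) * (log y / 2) ≤ ∑ n ∈ S, log n + √y * (log y / 2) := by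
    have hsmall : ((S.filter fun n : ℕ => (n : ℝ) ≤ √y).card : ℝ) ≤ √y := by
      have hsub : (S.filter fun n : ℕ => (n : ℝ) ≤ √y) ⊆ Ioc 0 ⌊√y⌋₊ := by
        intro n hn
        obtain ⟨hn, hny⟩ := mem_filter.1 hn
        exact mem_Ioc.2 ⟨(mem_smoothUpTo.1 hn).1.1, Nat.le_floor hny⟩
      calc ((S.filter fun n : ℕ => (n : ℝ) ≤ √y).card : ℝ) ≤ ((Ioc 0 ⌊√y⌋₊).card : ℝ) := by
            exact_mod_cast card_le_card hsub
        _ = (⌊√y⌋₊ : ℝ) := by simp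
        _ ≤ √y := Nat.floor_le (sqrt_nonneg _)
    calc (S.card : ℝ) * (log y / 2) = ∑ n ∈ S, log y / 2 := by simp
      _ ≤ ∑ n ∈ S, (log n + if (n : ℝ) ≤ √y then log y / 2 else 0) := by
          refine sum_le_sum fun n hn => ?_
          have hn1 : (1 : ℝ) ≤ n := by exact_mod_cast (mem_smoothUpTo.1 hn).1.1
          split_ifs with h
          · linarith [log_nonneg hn1]
          · rw [add_zero, ← log_sqrt hy0.le]
            exact log_le_log (sqrt_pos.2 hy0) (not_le.1 h).le
      _ = ∑ n ∈ S, log n + ((S.filter fun n : ℕ => (n : ℝ) ≤ √y).card : ℝ) * (log y / 2) := by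
          rw [sum_add_distrib, ← sum_filter, sum_const, nsmul_eq_mul]
      _ ≤ _ := by gcongr; linarith
  have hyσ : y ^ σ = y * exp (-(η * (log y / L))) := by
    rw [rpow_def_of_pos hy0]
    nth_rw 2 [← exp_log hy0]
    rw [← exp_add, hσ]
    congr 1; field_simp; ring
  have hAσ : A ^ (1 - σ) = exp η := by
    rw [rpow_def_of_pos hA0, hσ, ← hL]
    congr 1; field_simp; ring
  have hupper : ∑ n ∈ S, log n ≤ 28 * L * (y * exp (η - η * (log y / L) +
      8 * ((η + 1) * exp η))) := by
    calc ∑ n ∈ S, log n ≤ ∑ m ∈ S, ∑ d ∈ smoothUpTo (⌊A⌋₊ + 1) (y / m), Λ d :=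
          sum_log_smoothUpTo_le _ _
      _ ≤ ∑ m ∈ S, 14 * ((y / m) ^ σ * A ^ (1 - σ)) := by
          refine sum_le_sum fun m hm => ?_
          have hm' := (mem_smoothUpTo.1 hm).1
          have hm0 : (0 : ℝ) < m := by exact_mod_cast hm'.1
          have hmy : (m : ℝ) ≤ y := (Nat.le_floor_iff hy0.le).1 hm'.2
          exact sum_vonMangoldt_smoothUpTo_le hA1.le ((one_le_div hm0).2 hmy)
            (by linarith) (by linarith)
      _ = 14 * (y ^ σ * A ^ (1 - σ)) * ∑ m ∈ S, (m : ℝ) ^ (-σ) := by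
          rw [mul_sum]
          refine sum_congr rfl fun m _ => ?_
          rw [div_rpow hy0.le (Nat.cast_nonneg _), rpow_neg (Nat.cast_nonneg _)]
          ring
      _ ≤ 14 * (y ^ σ * A ^ (1 - σ)) * ((2 * L) * E) := by
          gcongr
          refine (sum_smoothUpTo_rpow_neg_le _ _ (by linarith)).trans ?_
          refine (prod_primesBelow_le hA1 hη hηA).trans ?_
          gcongr
          exact hzeta L hLA
      _ = _ := by
          rw [hyσ, hAσ, exp_add, sub_eq_add_neg, exp_add]
          ring
  have hfin : (S.card : ℝ) * (log y / 2) ≤ (√y + 56 * y * exp (η - η * (log y / L) +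
      8 * ((η + 1) * exp η))) * (log y / 2) := by
    have : 28 * L * (y * exp (η - η * (log y / L) + 8 * ((η + 1) * exp η))) ≤
        28 * log y * (y * exp (η - η * (log y / L) + 8 * ((η + 1) * exp η))) := by gcongr
    linarith
  exact le_of_mul_le_mul_right hfin (by linarith)

lemma tendsto_log2_atTop : Filter.Tendsto log2 Filter.atTop Filter.atTop :=
  tendsto_log_atTop.comp tendsto_log_atTop

/-- The error terms in the exponent are negligible compared with `u`. -/
lemma eventually_exponent_le {δ ε : ℝ} (hδ : 0 < δ) (hε : 0 < ε) :
    ∀ᶠ u : ℝ in Filter.atTop,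
      log 112 + (1 - δ) * log u + 8 * (((1 - δ) * log u + 1) * u ^ (1 - δ)) ≤ ε * u := by
  have h1 := (isLittleO_log_id_atTop).bound (show 0 < ε / 4 by positivity)
  have h2 := (isLittleO_log_rpow_atTop hδ).bound (show 0 < ε / 32 by positivity)
  have h3 := (tendsto_rpow_atTop hδ).eventually_ge_atTop (32 / ε)
  filter_upwards [h1, h2, h3, Filter.eventually_ge_atTop 1,
    Filter.eventually_ge_atTop (log 112 / (ε / 4))] with u h1 h2 h3 hu hu2
  have hu0 : 0 < u := by linarith
  have hlog : 0 ≤ log u := log_nonneg hu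
  rw [norm_of_nonneg hlog, id, norm_of_nonneg hu0.le] at h1
  rw [norm_of_nonneg hlog, norm_of_nonneg (by positivity)] at h2
  rw [div_le_iff₀ (by positivity)] at hu2 h3
  have h4 : (1 - δ) * log u ≤ log u := by nlinarith
  have h5 : (1 - δ) * log u + 1 ≤ ε / 16 * u ^ δ := by linarith
  have h6 : ((1 - δ) * log u + 1) * u ^ (1 - δ) ≤ ε / 16 * u := by
    calc ((1 - δ) * log u + 1) * u ^ (1 - δ) ≤ ε / 16 * u ^ δ * u ^ (1 - δ) := by gcongr
      _ = ε / 16 * u := by rw [mul_assoc, ← rpow_add hu0]; simp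
  linarith

lemma eventually_mul_le_exp (c : ℝ) : ∀ᶠ u : ℝ in Filter.atTop, c * u ≤ exp u := by
  filter_upwards [(tendsto_exp_div_pow_atTop 1).eventually_ge_atTop c,
    Filter.eventually_gt_atTop 0] with u hu hu0
  rwa [pow_one, le_div_iff₀ hu0] at hu

lemma eventually_card_smoothUpTo_alpha_le {c₀ : ℝ} (hc₀ : 0 < c₀) {ε : ℝ} (hε : 0 < ε) :
    ∀ᶠ x : ℝ in Filter.atTop,
      ((smoothUpTo (⌊alpha x⌋₊ + 1) (yOf c₀ x)).card : ℝ) ≤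
        yOf c₀ x / log x ^ ((4 : ℝ) - ε) := by
  obtain ⟨L₀, hL₀, hcard⟩ := exists_card_smoothUpTo_le
  set δ := min (ε / 8) 1 with hδdef
  have hδ : 0 < δ := by positivity
  have hδ1 : δ ≤ 1 := min_le_right _ _
  have hδε : 4 * δ ≤ ε / 2 := by linarith [min_le_left (ε / 8) 1]
  have hU := (((((eventually_exponent_le hδ (half_pos hε)).and
    (Filter.eventually_ge_atTop (exp 1))).and (eventually_mul_le_exp (c₀⁻¹ + 2 * log 2 + 8))).and
    (eventually_mul_le_exp 16)).and (eventually_mul_le_exp (4 * L₀)))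
  filter_upwards [tendsto_log2_atTop.eventually hU, Filter.eventually_gt_atTop (exp 1)]
    with x hx hx1
  obtain ⟨⟨⟨⟨hE, hu1⟩, hexp1⟩, hexp2⟩, hexp3⟩ := hx
  have hx0 : 0 < x := (exp_pos 1).trans hx1
  have hlx1 : 1 < log x := (lt_log_iff_exp_lt hx0).2 hx1
  have hlx0 : 0 < log x := by linarith
  set u := log2 x with hu
  have hu2 : 2 < u := by linarith [exp_one_gt_d9]
  have hu0 : 0 < u := by linarith
  have hlu : 1 ≤ log u := (le_log_iff_exp_le hu0).2 hu1
  have hlu0 : 0 < log u := by linarith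
  have hluu : log u ≤ u := by linarith [log_le_sub_one_of_pos hu0]
  have hexpu : exp u = log x := exp_log hlx0
  have hl3 : log3 x = log u := rfl
  set A := alpha x with hA
  set y := yOf c₀ x with hy
  have hA0 : 0 < A := rpow_pos_of_pos hx0 _
  have hL : log A = log u / (4 * u) * log x := by
    rw [hA, alpha, log_rpow hx0, hl3]
  have hLx : log A ≤ log x := by
    rw [hL]
    have : log u / (4 * u) ≤ 1 := by rw [div_le_one (by linarith)]; linarith
    nlinarith
  have hAx : A ≤ x := (log_le_log_iff hA0 hx0).1 hLx
  have hyeq : y = x * (c₀ * log u * log x / u) := by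
    rw [hy, yOf, hl3]; ring
  have hc : 0 < c₀⁻¹ := by positivity
  have hxy : x ≤ y := by
    rw [hyeq]
    refine le_mul_of_one_le_right hx0.le ?_
    rw [one_le_div hu0, ← hexpu]
    have h1 : c₀⁻¹ * u ≤ exp u := by nlinarith [log_pos one_lt_two]
    calc u = c₀ * 1 * (c₀⁻¹ * u) := by field_simp
      _ ≤ c₀ * log u * exp u := by gcongr
  have hy0 : 0 < y := hx0.trans_le hxy
  have hLL₀ : L₀ ≤ log A := by
    rw [hL, ← hexpu, div_mul_eq_mul_div, le_div_iff₀ (by linarith)]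
    nlinarith [exp_pos u]
  have hη : 0 ≤ (1 - δ) * log u := mul_nonneg (by linarith) hlu0.le
  have hηA : 4 * ((1 - δ) * log u) ≤ log A := by
    have h1 : (1 - δ) * log u ≤ log u := by nlinarith
    have h2 : 4 * log u ≤ log A := by
      rw [hL, ← hexpu, div_mul_eq_mul_div, le_div_iff₀ (by linarith)]
      nlinarith
    linarith
  have hmain := hcard A y _ hA0 hLL₀ (hAx.trans hxy) hη hηA
  have hexpη : exp ((1 - δ) * log u) = u ^ (1 - δ) := by
    rw [rpow_def_of_pos hu0, mul_comm]
  have hlogpow : log x ^ ((4 : ℝ) - ε) = exp ((4 - ε) * u) := by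
    rw [rpow_def_of_pos hlx0, mul_comm]; rfl
  have hratio : (4 - ε / 2) * u ≤ (1 - δ) * log u * (log y / log A) := by
    have hLpos : 0 < log A := by linarith
    have h1 : log x / log A = 4 * u / log u := by
      rw [hL]; field_simp
    calc (4 - ε / 2) * u ≤ (4 - 4 * δ) * u := by gcongr
      _ = (1 - δ) * log u * (log x / log A) := by rw [h1]; field_simp
      _ ≤ _ := by gcongr
  have hpart1 : 56 * y * exp ((1 - δ) * log u - (1 - δ) * log u * (log y / log A) +
      8 * (((1 - δ) * log u + 1) * exp ((1 - δ) * log u))) ≤ y * exp (-((4 - ε) * u)) / 2 := by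
    rw [hexpη]
    calc _ ≤ 56 * y * exp (-((4 - ε) * u) + -log 112) := by
          refine mul_le_mul_of_nonneg_left (exp_le_exp.2 ?_) (by positivity)
          linarith
      _ = _ := by
          rw [exp_add, exp_neg (log 112), exp_log (by norm_num)]
          ring
  have hpart2 : √y ≤ y * exp (-((4 - ε) * u)) / 2 := by
    have h1 : 2 * exp ((4 - ε) * u) ≤ √y := by
      calc 2 * exp ((4 - ε) * u) = exp (log 2 + (4 - ε) * u) := by
            rw [exp_add, exp_log two_pos]
        _ ≤ exp (log x / 2) := by
            have h2 : log 2 ≤ log 2 * u :=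
              le_mul_of_one_le_right (log_pos one_lt_two).le (by linarith)
            have h3 : 0 ≤ c₀⁻¹ * u := by positivity
            have h4 : 0 ≤ ε * u := by positivity
            rw [← hexpu]
            exact exp_le_exp.2 (by linarith)
        _ = √x := by rw [← log_sqrt hx0.le, exp_log (sqrt_pos.2 hx0)]
        _ ≤ √y := sqrt_le_sqrt hxy
    rw [exp_neg, ← div_eq_mul_inv, div_div, le_div_iff₀ (by positivity)]
    calc √y * (exp ((4 - ε) * u) * 2) ≤ √y * √y := by gcongr; linarith
      _ = y := mul_self_sqrt hy0.le
  rw [hlogpow, div_eq_mul_inv, ← exp_neg]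
  linarith

lemma eventually_yOf_div_log_sq_le {c₀ ε : ℝ} (hc₀ : 0 < c₀) (hε : 0 < ε) :
    ∀ᶠ x : ℝ in Filter.atTop, yOf c₀ x / log x ^ ((4 : ℝ) - 2) ≤ ε * x / log x := by
  have h := (isLittleO_log_id_atTop).bound (show 0 < ε / c₀ by positivity)
  filter_upwards [tendsto_log2_atTop.eventually (h.and (Filter.eventually_ge_atTop 1)),
    Filter.eventually_gt_atTop (exp 1)] with x hx hx1
  obtain ⟨hlog, hu⟩ := hx
  have hx0 : 0 < x := (exp_pos 1).trans hx1
  have hlx : 1 < log x := (lt_log_iff_exp_lt hx0).2 hx1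
  have hlx0 : 0 < log x := by linarith
  have hu0 : 0 < log2 x := by linarith
  rw [id, norm_of_nonneg (log_nonneg hu), norm_of_nonneg hu0.le, div_mul_eq_mul_div,
    le_div_iff₀ hc₀] at hlog
  have h3 : c₀ * log3 x / log2 x ≤ ε := by
    rw [div_le_iff₀ hu0, mul_comm c₀]
    exact hlog
  have h2 : log x ^ ((4 : ℝ) - 2) = log x ^ 2 := by
    rw [show (4 : ℝ) - 2 = (2 : ℕ) by norm_num, rpow_natCast]
  calc yOf c₀ x / log x ^ ((4 : ℝ) - 2) = c₀ * log3 x / log2 x * x / log x := by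
        rw [h2, yOf]; field_simp
    _ ≤ ε * x / log x := by gcongr

lemma card_filter_prime_le_smoothUpTo {A : ℝ} (y : ℝ) (s : Finset ℕ)
    (hs : ∀ n, n ∈ s ↔ n ∈ Icc 1 ⌊y⌋₊ ∧ ∀ p : ℕ, p.Prime → p ∣ n → (p : ℝ) ≤ A) :
    s.card ≤ (smoothUpTo (⌊A⌋₊ + 1) y).card := by
  refine card_le_card fun n hn => ?_
  obtain ⟨hn, hp⟩ := (hs n).1 hn
  exact mem_smoothUpTo.2 ⟨mem_Icc.1 hn, Nat.mem_smoothNumbers'.2 fun p hpp hpn =>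
    Nat.lt_succ_of_le (Nat.le_floor (hp p hpp hpn))⟩

end SmoothCounting

/-- Let `c₀ > 0` be fixed, `α = x^{log₃ x/(4 log₂ x)}`, `y = c₀ x (log x · log₃ x)/log₂ x`.
For every `ε > 0`, for all sufficiently large `x`, the number of `α`-smooth integers in `[1, y]`
is at most `y/(log x)^{4−ε}`; in particular it is `o(x/log x)`. -/
theorem statement16 (c₀ : ℝ) (hc₀ : 0 < c₀) (ε : ℝ) (hε : 0 < ε) :
    ∃ x₀ : ℝ, ∀ x : ℝ, x₀ ≤ x →
      ((((Finset.Icc 1 ⌊yOf c₀ x⌋₊).filter fun n =>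
            ∀ p : ℕ, p.Prime → p ∣ n → (p : ℝ) ≤ alpha x).card : ℝ) ≤
          yOf c₀ x / Real.log x ^ ((4 : ℝ) - ε)) ∧
      ((((Finset.Icc 1 ⌊yOf c₀ x⌋₊).filter fun n =>
            ∀ p : ℕ, p.Prime → p ∣ n → (p : ℝ) ≤ alpha x).card : ℝ) ≤
          ε * x / Real.log x) := by
  obtain ⟨x₀, hx₀⟩ := Filter.eventually_atTop.1
    ((eventually_card_smoothUpTo_alpha_le hc₀ hε).and
      ((eventually_card_smoothUpTo_alpha_le hc₀ two_pos).and
        (eventually_yOf_div_log_sq_le hc₀ hε)))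
  refine ⟨x₀, fun x hx => ?_⟩
  obtain ⟨h1, h2, h3⟩ := hx₀ x hx
  have hcard : ((((Finset.Icc 1 ⌊yOf c₀ x⌋₊).filter fun n =>
      ∀ p : ℕ, p.Prime → p ∣ n → (p : ℝ) ≤ alpha x).card : ℝ)) ≤
      (smoothUpTo (⌊alpha x⌋₊ + 1) (yOf c₀ x)).card :=
    Nat.cast_le.2 (card_filter_prime_le_smoothUpTo _ _ fun _ => Finset.mem_filter)
  exact ⟨hcard.trans h1, hcard.trans (h2.trans h3)⟩
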